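/- (Zink's lemma for the superspecial supersingular isocrystal.) Let M be a Dieudonné lattice in N. Then M_τ = ∑_{i≥0} τ^i(M) is a W-lattice satisfying F(M_τ) ⊆ M_τ, p·M_τ ⊆ F(M_τ), and τ(M_τ) ⊆ M_τ; moreover M ⊆ M_τ, and M_τ is contained in every τ-stable W-lattice in N that contains M (so M_τ is the unique smallest τ-stable lattice containing M). -/

import Mathlib

noncomputable section

open WittVector
open scoped Isocrystal

variable (p : ℕ) [Fact p.Prime] (k : Type*) [Field k] [IsAlgClosed k] [CharP k p]

/-- The Frobenius automorphism `σ` of `K(p, k) = Frac(W(k))`, the unique extension of the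
Witt vector Frobenius (itself the unique lift of `x ↦ x^p` on `k`). -/
def sigmaK : K(p, k) ≃+* K(p, k) := WittVector.FractionRing.frobenius p k

variable (g : ℕ)

/-- `N = K^{2g}`: a pair `(x, y)` encodes the vector `∑ᵢ xᵢ·eᵢ + ∑ᵢ yᵢ·fᵢ` in the basis
`e_1, …, e_g, f_1, …, f_g`. -/
abbrev Nspace := (Fin g → K(p, k)) × (Fin g → K(p, k))

/-- The basis vector `e_i` (0-indexed). -/
def eVec (i : Fin g) : Nspace p k g := (Pi.single i 1, 0)

/-- The basis vector `f_i` (0-indexed). -/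
def fVec (i : Fin g) : Nspace p k g := (0, Pi.single i 1)

/-- The `σ`-semilinear Frobenius `F : N → N`, with `F(e_i) = f_i`, `F(f_i) = p·e_i`. -/
def Fmap (v : Nspace p k g) : Nspace p k g :=
  (fun i => (p : K(p, k)) * sigmaK p k (v.2 i), fun i => sigmaK p k (v.1 i))

/-- The Verschiebung `V = p·F⁻¹ : N → N`, with `V(e_i) = f_i`, `V(f_i) = p·e_i`,
`σ⁻¹`-semilinear. -/
def Vmap (v : Nspace p k g) : Nspace p k g :=
  (fun i => (p : K(p, k)) * (sigmaK p k).symm (v.2 i), fun i => (sigmaK p k).symm (v.1 i))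

/-- `τ = p⁻¹·F²` acts coordinatewise by `σ²`. -/
def tauMap (v : Nspace p k g) : Nspace p k g :=
  (fun i => sigmaK p k (sigmaK p k (v.1 i)), fun i => sigmaK p k (sigmaK p k (v.2 i)))

/-- A `W`-lattice in `N`: a finitely generated `W(k)`-submodule spanning `N` over `K`. -/
def IsLattice (L : Submodule (WittVector p k) (Nspace p k g)) : Prop :=
  L.FG ∧ Submodule.span K(p, k) (L : Set (Nspace p k g)) = ⊤

/-- A Dieudonné lattice: a `W`-lattice `M` with `F(M) ⊆ M` and `p·M ⊆ F(M)`. -/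
def IsDieudonneLattice (M : Submodule (WittVector p k) (Nspace p k g)) : Prop :=
  IsLattice p k g M ∧ (∀ v ∈ M, Fmap p k g v ∈ M) ∧
    ∀ v ∈ M, ∃ w ∈ M, Fmap p k g w = (p : K(p, k)) • v

/-- `L` is `τ`-stable: `τ(L) ⊆ L`. -/
def TauStable (L : Submodule (WittVector p k) (Nspace p k g)) : Prop :=
  ∀ v ∈ L, tauMap p k g v ∈ L

/-- `M_τ = ∑_{i ≥ 0} τ^i(M)`, the `W(k)`-submodule generated by all iterates of `τ`
applied to `M`. -/
def Mtau (M : Submodule (WittVector p k) (Nspace p k g)) :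
    Submodule (WittVector p k) (Nspace p k g) :=
  Submodule.span (WittVector p k) (⋃ i : ℕ, (tauMap p k g)^[i] '' (M : Set (Nspace p k g)))

/-- The symplectic pairing with `⟨e_i, f_{g+1−i}⟩ = 1`, `⟨f_i, e_{g+1−i}⟩ = −1` and all
other pairings of basis vectors zero. -/
def pairN (v w : Nspace p k g) : K(p, k) :=
  ∑ i : Fin g, (v.1 i * w.2 (Fin.rev i) - v.2 i * w.1 (Fin.rev i))

/-- The dual `L^∨ = {x ∈ N : ⟨x, m⟩ ∈ W for all m ∈ L}` of a set `L ⊆ N`. -/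
def dualSet (L : Set (Nspace p k g)) : Set (Nspace p k g) :=
  {x | ∀ m ∈ L, ∃ w : WittVector p k, algebraMap (WittVector p k) K(p, k) w = pairN p k g x m}

/-- `𝒟v`: the `W(k)`-submodule generated by all `F^a V^b v`, `a, b ≥ 0`. -/
def Dspan (v : Nspace p k g) : Submodule (WittVector p k) (Nspace p k g) :=
  Submodule.span (WittVector p k)
    {w | ∃ a b : ℕ, w = (Fmap p k g)^[a] ((Vmap p k g)^[b] v)}

section Semilinear

variable {p k g}

theorem sigmaK_algebraMap (w : WittVector p k) :
    sigmaK p k (algebraMap _ K(p, k) w) = algebraMap _ K(p, k) (frobeniusEquiv p k w) :=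
  IsFractionRing.ringEquivOfRingEquiv_algebraMap _ _

theorem sigmaK_smul (w : WittVector p k) (x : K(p, k)) :
    sigmaK p k (w • x) = frobeniusEquiv p k w • sigmaK p k x := by
  rw [Algebra.smul_def, Algebra.smul_def, map_mul, sigmaK_algebraMap]

theorem Fmap_zero : Fmap p k g 0 = 0 := by
  ext i <;> simp [Fmap]

theorem Fmap_add (v w : Nspace p k g) : Fmap p k g (v + w) = Fmap p k g v + Fmap p k g w := by
  ext i <;> simp [Fmap, mul_add]

theorem Fmap_smul (w : WittVector p k) (v : Nspace p k g) :
    Fmap p k g (w • v) = frobeniusEquiv p k w • Fmap p k g v := by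
  ext i <;> simp [Fmap, sigmaK_smul]

theorem tauMap_zero : tauMap p k g 0 = 0 := by
  ext i <;> simp [tauMap]

theorem tauMap_add (v w : Nspace p k g) :
    tauMap p k g (v + w) = tauMap p k g v + tauMap p k g w := by
  ext i <;> simp [tauMap]

theorem tauMap_smul (w : WittVector p k) (v : Nspace p k g) :
    tauMap p k g (w • v) = frobeniusEquiv p k (frobeniusEquiv p k w) • tauMap p k g v := by
  ext i <;> simp [tauMap, sigmaK_smul]

theorem tauMap_p_smul (v : Nspace p k g) :
    tauMap p k g ((p : K(p, k)) • v) = (p : K(p, k)) • tauMap p k g v := by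
  ext i <;> simp [tauMap]

theorem Fmap_iterate_tauMap (i : ℕ) (v : Nspace p k g) :
    Fmap p k g ((tauMap p k g)^[i] v) = (tauMap p k g)^[i] (Fmap p k g v) := by
  refine (Function.Commute.iterate_right (fun v => ?_) i) v
  ext i <;> simp [Fmap, tauMap]

theorem iterate_tauMap_p_smul (i : ℕ) (v : Nspace p k g) :
    (tauMap p k g)^[i] ((p : K(p, k)) • v) = (p : K(p, k)) • (tauMap p k g)^[i] v :=
  (Function.Commute.iterate_left (fun v => tauMap_p_smul v) i) v

end Semilinear

section Mtau

variable {p k g}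

theorem iterate_tauMap_mem_Mtau {M : Submodule (WittVector p k) (Nspace p k g)}
    {v : Nspace p k g} (hv : v ∈ M) (i : ℕ) : (tauMap p k g)^[i] v ∈ Mtau p k g M :=
  Submodule.subset_span (Set.mem_iUnion.2 ⟨i, v, hv, rfl⟩)

theorem le_Mtau (M : Submodule (WittVector p k) (Nspace p k g)) : M ≤ Mtau p k g M :=
  fun _ hv => iterate_tauMap_mem_Mtau hv 0

theorem Mtau_induction {M : Submodule (WittVector p k) (Nspace p k g)}
    {P : Nspace p k g → Prop} (iter : ∀ v ∈ M, ∀ i, P ((tauMap p k g)^[i] v)) (zero : P 0)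
    (add : ∀ v w, P v → P w → P (v + w)) (smul : ∀ (a : WittVector p k) v, P v → P (a • v)) :
    ∀ v ∈ Mtau p k g M, P v := by
  intro v hv
  induction hv using Submodule.span_induction with
  | mem x hx =>
    obtain ⟨i, y, hy, rfl⟩ := Set.mem_iUnion.1 hx
    exact iter y hy i
  | zero => exact zero
  | add x y _ _ hx hy => exact add x y hx hy
  | smul a x _ hx => exact smul a x hx

theorem Mtau_le {M L : Submodule (WittVector p k) (Nspace p k g)}
    (hL : TauStable p k g L) (h : M ≤ L) : Mtau p k g M ≤ L := by
  refine Mtau_induction (fun v hv i => ?_) L.zero_mem (fun _ _ => L.add_mem)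
    fun a _ => L.smul_mem a
  induction i with
  | zero => exact h hv
  | succ i ih =>
    rw [Function.iterate_succ_apply']
    exact hL _ ih

theorem tauStable_Mtau (M : Submodule (WittVector p k) (Nspace p k g)) :
    TauStable p k g (Mtau p k g M) := by
  refine Mtau_induction (fun v hv i => ?_) ?_ (fun v w hv hw => ?_) fun a v hv => ?_
  · rw [← Function.iterate_succ_apply' (tauMap p k g)]
    exact iterate_tauMap_mem_Mtau hv _
  · rw [tauMap_zero]
    exact zero_mem _
  · rw [tauMap_add]
    exact add_mem hv hw
  · rw [tauMap_smul]
    exact Submodule.smul_mem _ _ hv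

theorem Fmap_mem_Mtau {M : Submodule (WittVector p k) (Nspace p k g)}
    (hM : ∀ v ∈ M, Fmap p k g v ∈ M) :
    ∀ v ∈ Mtau p k g M, Fmap p k g v ∈ Mtau p k g M := by
  refine Mtau_induction (fun v hv i => ?_) ?_ (fun v w hv hw => ?_) fun a v hv => ?_
  · rw [Fmap_iterate_tauMap]
    exact iterate_tauMap_mem_Mtau (hM v hv) i
  · rw [Fmap_zero]
    exact zero_mem _
  · rw [Fmap_add]
    exact add_mem hv hw
  · rw [Fmap_smul]
    exact Submodule.smul_mem _ _ hv

theorem exists_Fmap_eq_p_smul_of_mem_Mtau {M : Submodule (WittVector p k) (Nspace p k g)}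
    (hM : ∀ v ∈ M, ∃ w ∈ M, Fmap p k g w = (p : K(p, k)) • v) :
    ∀ v ∈ Mtau p k g M, ∃ w ∈ Mtau p k g M, Fmap p k g w = (p : K(p, k)) • v := by
  refine Mtau_induction (fun v hv i => ?_) ?_ ?_ ?_
  · obtain ⟨w, hw, h⟩ := hM v hv
    exact ⟨_, iterate_tauMap_mem_Mtau hw i, by
      rw [Fmap_iterate_tauMap, h, iterate_tauMap_p_smul]⟩
  · exact ⟨0, zero_mem _, by rw [Fmap_zero, smul_zero]⟩
  · rintro v w ⟨v', hv', hv⟩ ⟨w', hw', hw⟩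
    exact ⟨v' + w', add_mem hv' hw', by rw [Fmap_add, hv, hw, smul_add]⟩
  · rintro a v ⟨v', hv', hv⟩
    exact ⟨(frobeniusEquiv p k).symm a • v', Submodule.smul_mem _ _ hv', by
      rw [Fmap_smul, RingEquiv.apply_symm_apply, hv, smul_comm]⟩

end Mtau

section Finiteness

open Filter

/-- The standard lattice `W^{2g}` in `N`. -/
def stdLattice : Submodule (WittVector p k) (Nspace p k g) :=
  LinearMap.range (((Algebra.linearMap (WittVector p k) K(p, k)).compLeft (Fin g)).prodMap
    ((Algebra.linearMap (WittVector p k) K(p, k)).compLeft (Fin g)))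

/-- The lattice `p⁻ⁿ W^{2g}` in `N`. -/
def scaledStdLattice (n : ℕ) : Submodule (WittVector p k) (Nspace p k g) :=
  (stdLattice p k g).comap (LinearMap.lsmul _ _ ((p : WittVector p k) ^ n))

variable {p k g}

omit [IsAlgClosed k] [CharP k p] in
theorem mem_scaledStdLattice {n : ℕ} {v : Nspace p k g} :
    v ∈ scaledStdLattice p k g n ↔
      (∀ i, ∃ a, algebraMap (WittVector p k) K(p, k) a = (p : WittVector p k) ^ n • v.1 i) ∧
      ∀ i, ∃ a, algebraMap (WittVector p k) K(p, k) a = (p : WittVector p k) ^ n • v.2 i := by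
  constructor
  · rintro ⟨⟨a, b⟩, h⟩
    exact ⟨fun i => ⟨a i, congrFun (congrArg Prod.fst h) i⟩,
      fun i => ⟨b i, congrFun (congrArg Prod.snd h) i⟩⟩
  · rintro ⟨ha, hb⟩
    choose a ha using ha
    choose b hb using hb
    exact ⟨(a, b), Prod.ext (funext ha) (funext hb)⟩

theorem fg_scaledStdLattice (n : ℕ) : (scaledStdLattice p k g n).FG := by
  have hp : (p : WittVector p k) ^ n ≠ 0 := pow_ne_zero n (irreducible p).ne_zero
  have : IsNoetherian (WittVector p k) (stdLattice p k g) := by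
    unfold stdLattice
    infer_instance
  refine Submodule.fg_of_fg_map_injective (LinearMap.lsmul _ _ ((p : WittVector p k) ^ n))
    (fun v w h => ?_) (Submodule.FG.of_le (isNoetherian_submodule.1 this _ le_rfl)
      (Submodule.map_comap_le _ _))
  exact smul_right_injective _ hp h

theorem tauStable_scaledStdLattice (n : ℕ) : TauStable p k g (scaledStdLattice p k g n) := by
  have key (x : K(p, k)) (hx : ∃ a, algebraMap (WittVector p k) K(p, k) a =
      (p : WittVector p k) ^ n • x) : ∃ a, algebraMap (WittVector p k) K(p, k) a =
      (p : WittVector p k) ^ n • sigmaK p k (sigmaK p k x) := by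
    obtain ⟨a, ha⟩ := hx
    refine ⟨frobeniusEquiv p k (frobeniusEquiv p k a), ?_⟩
    rw [← sigmaK_algebraMap, ← sigmaK_algebraMap, ha, sigmaK_smul, sigmaK_smul]
    simp only [map_pow, map_natCast]
  intro v hv
  rw [mem_scaledStdLattice] at hv ⊢
  exact ⟨fun i => key _ (hv.1 i), fun i => key _ (hv.2 i)⟩

theorem eventually_p_pow_smul_integral (x : K(p, k)) :
    ∀ᶠ n in atTop, ∃ a, algebraMap (WittVector p k) K(p, k) a = (p : WittVector p k) ^ n • x := by
  obtain ⟨a, b, hb, rfl⟩ := IsFractionRing.div_surjective (A := WittVector p k) x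
  have hb0 := nonZeroDivisors.ne_zero hb
  obtain ⟨m, u, rfl⟩ := exists_eq_pow_p_mul' b hb0
  filter_upwards [eventually_ge_atTop m] with n hn
  obtain ⟨d, rfl⟩ := Nat.exists_eq_add_of_le hn
  have hb' : algebraMap (WittVector p k) K(p, k) (p ^ m * u) ≠ 0 :=
    (map_ne_zero_iff _ (IsFractionRing.injective _ _)).2 hb0
  refine ⟨p ^ d * ↑u⁻¹ * a, ?_⟩
  rw [Algebra.smul_def, ← mul_div_assoc, eq_div_iff hb', ← map_mul, ← map_mul]
  congr 1
  linear_combination (p : WittVector p k) ^ (m + d) * a * u.inv_mul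

theorem exists_le_scaledStdLattice {M : Submodule (WittVector p k) (Nspace p k g)} (hM : M.FG) :
    ∃ n, M ≤ scaledStdLattice p k g n := by
  obtain ⟨S, rfl⟩ := hM
  have h : ∀ᶠ n in atTop, ∀ v ∈ S, v ∈ scaledStdLattice p k g n := by
    refine (eventually_all_finset S).2 fun v _ => ?_
    simp only [mem_scaledStdLattice]
    exact (eventually_all.2 fun i => eventually_p_pow_smul_integral (v.1 i)).and
      (eventually_all.2 fun i => eventually_p_pow_smul_integral (v.2 i))
  obtain ⟨n, hn⟩ := h.exists
  exact ⟨n, Submodule.span_le.2 hn⟩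

theorem isLattice_Mtau {M : Submodule (WittVector p k) (Nspace p k g)} (hM : IsLattice p k g M) :
    IsLattice p k g (Mtau p k g M) := by
  obtain ⟨n, hn⟩ := exists_le_scaledStdLattice hM.1
  refine ⟨(fg_scaledStdLattice n).of_le (Mtau_le (tauStable_scaledStdLattice n) hn), ?_⟩
  exact top_unique (hM.2.ge.trans (Submodule.span_mono (le_Mtau M)))

end Finiteness

/-- Zink's lemma: for a Dieudonné lattice `M` in `N`, the module
`M_τ = ∑_{i≥0} τ^i(M)` is a `W`-lattice with `F(M_τ) ⊆ M_τ`, `p·M_τ ⊆ F(M_τ)` and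
`τ(M_τ) ⊆ M_τ`; it contains `M` and is contained in every `τ`-stable `W`-lattice
containing `M`. -/
theorem stmt7 (hg : 1 ≤ g) (M : Submodule (WittVector p k) (Nspace p k g))
    (hM : IsDieudonneLattice p k g M) :
    IsLattice p k g (Mtau p k g M) ∧
    (∀ v ∈ Mtau p k g M, Fmap p k g v ∈ Mtau p k g M) ∧
    (∀ v ∈ Mtau p k g M, ∃ w ∈ Mtau p k g M, Fmap p k g w = (p : K(p, k)) • v) ∧
    TauStable p k g (Mtau p k g M) ∧
    M ≤ Mtau p k g M ∧
    ∀ L : Submodule (WittVector p k) (Nspace p k g),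
      IsLattice p k g L → TauStable p k g L → M ≤ L → Mtau p k g M ≤ L := by
  exact ⟨isLattice_Mtau hM.1, Fmap_mem_Mtau hM.2.1, exists_Fmap_eq_p_smul_of_mem_Mtau hM.2.2,
    tauStable_Mtau M, le_Mtau M, fun _ _ hL h => Mtau_le hL h⟩
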